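/- arXiv:2202.01271 — 6 statements merged into one kernel-verified Lean document; each statement's English description precedes it below -/
import Mathlib

section
/- Let C be a monoidal category whose underlying category is a groupoid and in which every object admits a weak inverse. Then the Drinfel'd centre Z(C) has the same two properties: every morphism of Z(C) is an isomorphism, and every object of Z(C) admits a weak inverse with respect to the tensor product of Z(C). Moreover, if (X,γ) is an object of Z(C) and Y is a weak inverse of X in C, then Y carries a half-braiding γ' making (Y,γ') a weak inverse of (X,γ) in Z(C). -/
open CategoryTheory MonoidalCategory

/-- An object `X` of a monoidal category has a weak inverse `Y` if
`X ⊗ Y ≅ 𝟙` and `Y ⊗ X ≅ 𝟙`. -/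
def IsWeakInverse {C : Type*} [Category C] [MonoidalCategory C] (X Y : C) : Prop :=
  Nonempty (X ⊗ Y ≅ 𝟙_ C) ∧ Nonempty (Y ⊗ X ≅ 𝟙_ C)

section WeakInverse

variable {C : Type*} [Category C] [MonoidalCategory C]

/-- Tensoring on the left with a weakly invertible object is an equivalence. -/
theorem IsWeakInverse.isEquivalence_tensorLeft {X Y : C} (h : IsWeakInverse X Y) :
    (tensorLeft X).IsEquivalence := by
  obtain ⟨⟨e⟩, ⟨d⟩⟩ := h
  exact (CategoryTheory.Equivalence.mk (tensorLeft X) (tensorLeft Y)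
    ((leftUnitorNatIso C).symm ≪≫ (tensoringLeft C).mapIso d.symm ≪≫ tensorLeftTensor Y X)
    ((tensorLeftTensor X Y).symm ≪≫ (tensoringLeft C).mapIso e ≪≫
      leftUnitorNatIso C)).isEquivalence_functor

/-- The isomorphism `X ⊗ (Y ⊗ U) ≅ X ⊗ (U ⊗ Y)` which a half-braiding on `Y` has to induce for
`e : X ⊗ Y ≅ 𝟙_ C` to be compatible with the half-braidings. -/
def CategoryTheory.HalfBraiding.conjIso {X Y : C} (γ : HalfBraiding X) (e : X ⊗ Y ≅ 𝟙_ C)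
    (U : C) : X ⊗ (Y ⊗ U) ≅ X ⊗ (U ⊗ Y) :=
  (α_ X Y U).symm ≪≫ whiskerRightIso e U ≪≫ λ_ U ≪≫ (ρ_ U).symm ≪≫ whiskerLeftIso U e.symm ≪≫
    (α_ U X Y).symm ≪≫ whiskerRightIso (γ.β U).symm Y ≪≫ α_ X U Y

theorem CategoryTheory.HalfBraiding.conjIso_hom {X Y : C} (γ : HalfBraiding X)
    (e : X ⊗ Y ≅ 𝟙_ C) (U : C) :
    (γ.conjIso e U).hom = (α_ X Y U).inv ≫ e.hom ▷ U ≫ (λ_ U).hom ≫ (ρ_ U).inv ≫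
      U ◁ e.inv ≫ (α_ U X Y).inv ≫ (γ.β U).inv ▷ Y ≫ (α_ X U Y).hom :=
  rfl

theorem CategoryTheory.HalfBraiding.conjIso_naturality {X Y : C} (γ : HalfBraiding X)
    (e : X ⊗ Y ≅ 𝟙_ C) {U V : C} (f : U ⟶ V) :
    X ◁ Y ◁ f ≫ (γ.conjIso e V).hom = (γ.conjIso e U).hom ≫ X ◁ f ▷ Y := by
  have hγ : f ▷ X ≫ (γ.β V).inv = (γ.β U).inv ≫ X ◁ f := by
    rw [Iso.comp_inv_eq, Category.assoc, γ.naturality, Iso.inv_hom_id_assoc]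
  rw [γ.conjIso_hom, γ.conjIso_hom]
  calc
    _ = 𝟙 _ ⊗≫ ((X ⊗ Y) ◁ f ≫ e.hom ▷ V) ⊗≫ V ◁ e.inv ⊗≫ (γ.β V).inv ▷ Y ⊗≫ 𝟙 _ := by
      monoidal
    _ = 𝟙 _ ⊗≫ e.hom ▷ U ⊗≫ (f ▷ 𝟙_ C ≫ V ◁ e.inv) ⊗≫ (γ.β V).inv ▷ Y ⊗≫ 𝟙 _ := by
      rw [whisker_exchange]; monoidal
    _ = 𝟙 _ ⊗≫ e.hom ▷ U ⊗≫ U ◁ e.inv ⊗≫ (f ▷ X ≫ (γ.β V).inv) ▷ Y ⊗≫ 𝟙 _ := by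
      rw [← whisker_exchange]; monoidal
    _ = _ := by rw [hγ]; monoidal

theorem CategoryTheory.HalfBraiding.conjIso_tensor {X Y : C} (γ : HalfBraiding X)
    (e : X ⊗ Y ≅ 𝟙_ C) {U V : C} (g : Y ⊗ U ⟶ U ⊗ Y) (h : Y ⊗ V ⟶ V ⊗ Y)
    (hg : X ◁ g = (γ.conjIso e U).hom) (hh : X ◁ h = (γ.conjIso e V).hom) :
    (γ.conjIso e (U ⊗ V)).hom =
      X ◁ ((α_ Y U V).inv ≫ g ▷ V ≫ (α_ U Y V).hom ≫ U ◁ h ≫ (α_ U V Y).inv) := by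
  have hγ : (γ.β (U ⊗ V)).inv = (α_ U V X).hom ≫ U ◁ (γ.β V).inv ≫ (α_ U X V).inv ≫
      (γ.β U).inv ▷ V ≫ (α_ X U V).hom := by
    rw [← cancel_epi (γ.β (U ⊗ V)).hom, Iso.hom_inv_id, γ.monoidal]
    simp [← MonoidalCategory.whiskerLeft_comp_assoc, ← comp_whiskerRight_assoc]
  symm
  calc
    _ = 𝟙 _ ⊗≫ (X ◁ g) ▷ V ⊗≫ X ◁ U ◁ h ⊗≫ 𝟙 _ := by monoidal
    _ = 𝟙 _ ⊗≫ e.hom ▷ U ▷ V ⊗≫ U ◁ e.inv ▷ V ⊗≫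
        ((γ.β U).inv ▷ (Y ⊗ V) ≫ (X ⊗ U) ◁ h) ⊗≫ 𝟙 _ := by
      rw [hg, γ.conjIso_hom]; monoidal
    _ = 𝟙 _ ⊗≫ e.hom ▷ U ▷ V ⊗≫ U ◁ e.inv ▷ V ⊗≫ U ◁ (X ◁ h) ⊗≫
        (γ.β U).inv ▷ (V ⊗ Y) ⊗≫ 𝟙 _ := by
      rw [← whisker_exchange]; monoidal
    _ = 𝟙 _ ⊗≫ e.hom ▷ U ▷ V ⊗≫ U ◁ (e.inv ≫ e.hom) ▷ V ⊗≫ U ◁ V ◁ e.inv ⊗≫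
        U ◁ (γ.β V).inv ▷ Y ⊗≫ (γ.β U).inv ▷ (V ⊗ Y) ⊗≫ 𝟙 _ := by
      rw [hh, γ.conjIso_hom]; monoidal
    _ = _ := by rw [e.inv_hom_id, γ.conjIso_hom, hγ]; monoidal

/-- The half-braiding on a weak inverse `Y` of `X` induced by a half-braiding on `X`. -/
noncomputable def CategoryTheory.HalfBraiding.ofWeakInverse {X Y : C} (γ : HalfBraiding X)
    (e : X ⊗ Y ≅ 𝟙_ C) [(tensorLeft X).IsEquivalence] : HalfBraiding Y where
  β U := (tensorLeft X).preimageIso (γ.conjIso e U)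
  monoidal U V := (tensorLeft X).map_injective <|
    ((tensorLeft X).map_preimage _).trans <| γ.conjIso_tensor e _ _
      ((tensorLeft X).map_preimage _) ((tensorLeft X).map_preimage _)
  naturality {U V} f := (tensorLeft X).map_injective <| by
    rw [Functor.map_comp, Functor.map_comp, Functor.preimageIso_hom, Functor.preimageIso_hom,
      Functor.map_preimage, Functor.map_preimage]
    exact γ.conjIso_naturality e f

theorem CategoryTheory.HalfBraiding.whiskerLeft_ofWeakInverse_β_hom {X Y : C}
    (γ : HalfBraiding X) (e : X ⊗ Y ≅ 𝟙_ C) [(tensorLeft X).IsEquivalence] (U : C) :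
    X ◁ ((γ.ofWeakInverse e).β U).hom = (γ.conjIso e U).hom :=
  (tensorLeft X).map_preimage _

theorem CategoryTheory.HalfBraiding.ofWeakInverse_comm {X Y : C} (γ : HalfBraiding X)
    (e : X ⊗ Y ≅ 𝟙_ C) [(tensorLeft X).IsEquivalence] (U : C) :
    e.hom ▷ U ≫ (λ_ U ≪≫ (ρ_ U).symm).hom =
      (α_ X Y U ≪≫ whiskerLeftIso X ((γ.ofWeakInverse e).β U) ≪≫ (α_ X U Y).symm ≪≫
        whiskerRightIso (γ.β U) Y ≪≫ α_ U X Y).hom ≫ U ◁ e.hom := by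
  simp only [Iso.trans_hom, whiskerLeftIso_hom, Iso.symm_hom, whiskerRightIso_hom]
  rw [γ.whiskerLeft_ofWeakInverse_β_hom, γ.conjIso_hom]
  simp [← MonoidalCategory.whiskerLeft_comp, ← comp_whiskerRight_assoc]

/-- The isomorphism `e : X ⊗ Y ≅ 𝟙_ C` lifts to the Drinfeld centre. -/
noncomputable def CategoryTheory.HalfBraiding.tensorOfWeakInverseIso {X Y : C}
    (γ : HalfBraiding X) (e : X ⊗ Y ≅ 𝟙_ C) [(tensorLeft X).IsEquivalence] :
    tensorObj (C := Center C) ⟨X, γ⟩ ⟨Y, γ.ofWeakInverse e⟩ ≅ 𝟙_ (Center C) :=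
  let f : tensorObj (C := Center C) ⟨X, γ⟩ ⟨Y, γ.ofWeakInverse e⟩ ⟶ 𝟙_ (Center C) :=
    { f := e.hom
      comm := γ.ofWeakInverse_comm e }
  haveI : IsIso f.f := inferInstanceAs (IsIso e.hom)
  Center.isoMk f

theorem IsWeakInverse.exists_halfBraiding {X Y : C} (h : IsWeakInverse X Y)
    (γ : HalfBraiding X) :
    ∃ γ' : HalfBraiding Y, IsWeakInverse (C := Center C) ⟨X, γ⟩ ⟨Y, γ'⟩ := by
  have := h.isEquivalence_tensorLeft
  obtain ⟨⟨e⟩, -⟩ := h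
  exact ⟨γ.ofWeakInverse e, ⟨γ.tensorOfWeakInverseIso e⟩,
    ⟨β_ _ _ ≪≫ γ.tensorOfWeakInverseIso e⟩⟩

end WeakInverse

/-- The Drinfel'd centre of a 2-group is a 2-group, and a weak inverse of the underlying
object of a centre piece carries a half-braiding making it a weak inverse in the centre. -/
theorem drinfeld_centre_of_two_group_is_two_group
    {C : Type*} [Category C] [MonoidalCategory C]
    (hgpd : ∀ {X Y : C} (f : X ⟶ Y), IsIso f)
    (hinv : ∀ X : C, ∃ Y : C, IsWeakInverse X Y) :
    (∀ {Z W : Center C} (f : Z ⟶ W), IsIso f) ∧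
    (∀ Z : Center C, ∃ W : Center C, IsWeakInverse Z W) ∧
    (∀ (Z : Center C) (Y : C), IsWeakInverse Z.1 Y →
      ∃ γ' : HalfBraiding Y, IsWeakInverse (C := Center C) Z ⟨Y, γ'⟩) := by
  refine ⟨fun f => ?_, fun Z => ?_, fun Z Y h => h.exists_halfBraiding Z.2⟩
  · have := hgpd f.f
    infer_instance
  · obtain ⟨Y, h⟩ := hinv Z.1
    obtain ⟨γ', h'⟩ := h.exists_halfBraiding Z.2
    exact ⟨⟨Y, γ'⟩, h'⟩
end

section
/- Let H be a group, A an abelian group regarded as a trivial H-module, and ω : H × H × H → A a 3-cocycle. For every element g of the centre of H, the function ω_g : H × H → A defined by ω_g(x,y) := ω(x,g,y) − ω(g,x,y) − ω(x,y,g) is a 2-cocycle, i.e. ω_g(y,z) − ω_g(xy,z) + ω_g(x,yz) − ω_g(x,y) = 0 for all x, y, z in H. -/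
/-- A 3-cocycle on a group `H` with values in a trivial `H`-module `A`. -/
def IsThreeCocycle {H : Type*} [Group H] {A : Type*} [AddCommGroup A]
    (ω : H → H → H → A) : Prop :=
  ∀ x y z w : H,
    ω y z w - ω (x * y) z w + ω x (y * z) w - ω x y (z * w) + ω x y z = 0

/-- The 2-cochain `ω_g(x,y) = ω(x,g,y) − ω(g,x,y) − ω(x,y,g)` associated to a central
element `g`. -/
def obstructionCochain {H : Type*} [Group H] {A : Type*} [AddCommGroup A]
    (ω : H → H → H → A) (g : H) : H → H → A :=
  fun x y => ω x g y - ω g x y - ω x y g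

/-- For a 3-cocycle `ω` and a central element `g`, the cochain `ω_g` is a 2-cocycle. -/
theorem obstructionCochain_is_two_cocycle
    {H : Type*} [Group H] {A : Type*} [AddCommGroup A]
    (ω : H → H → H → A) (hω : IsThreeCocycle ω)
    (g : H) (hg : g ∈ Subgroup.center H) :
    ∀ x y z : H,
      obstructionCochain ω g y z - obstructionCochain ω g (x * y) z
        + obstructionCochain ω g x (y * z) - obstructionCochain ω g x y = 0 := by
  intro x y z
  have comm : ∀ h : H, h * g = g * h := Subgroup.mem_center_iff.mp hg
  have h₁ := hω g x y z
  have h₂ := hω x g y z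
  have h₃ := hω x y g z
  have h₄ := hω x y z g
  rw [comm] at h₂ h₃ h₄
  have key := congrArg₂ (· + ·) (congrArg₂ (· - ·) h₁ h₂) (congrArg₂ (· - ·) h₃ h₄)
  simp only [sub_self, add_zero] at key
  rw [← key]
  simp only [obstructionCochain]
  abel
end

section
/- Let H be a group, A an abelian group regarded as a trivial H-module, and ω : H × H × H → A a 3-cocycle. Then the assignment g ↦ [ω_g] is a group homomorphism from the centre Z(H) of H to the second group cohomology H²(H;A): for all central g, g′ there exists a function c : H → A such that ω_{gg′}(x,y) − ω_g(x,y) − ω_{g′}(x,y) = c(xy) − c(x) − c(y) for all x, y in H. -/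
/-- The assignment `g ↦ [ω_g]` is a homomorphism `Z(H) → H²(H;A)`: the 2-cocycles
`ω_{gg′}` and `ω_g + ω_{g′}` differ by a coboundary. -/
theorem obstruction_is_group_hom
    {H : Type*} [Group H] {A : Type*} [AddCommGroup A]
    (ω : H → H → H → A) (hω : IsThreeCocycle ω)
    (g g' : H) (hg : g ∈ Subgroup.center H) (hg' : g' ∈ Subgroup.center H) :
    ∃ c : H → A, ∀ x y : H,
      obstructionCochain ω (g * g') x y - obstructionCochain ω g x y
        - obstructionCochain ω g' x y = c (x * y) - c x - c y := by
  have comm (x : H) : g * x = x * g := (Subgroup.mem_center_iff.mp hg x).symm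
  have comm' (x : H) : g' * x = x * g' := (Subgroup.mem_center_iff.mp hg' x).symm
  refine ⟨fun x => ω x g g' - ω g x g' + ω g g' x, fun x y => ?_⟩
  have h₁ := hω x y g g'
  have h₂ := hω x g y g'
  have h₃ := hω x g g' y
  have h₄ := hω g x y g'
  have h₅ := hω g x g' y
  have h₆ := hω g g' x y
  rw [comm y] at h₂
  rw [comm' y] at h₃
  rw [comm x] at h₄
  rw [comm x, comm' y] at h₅
  rw [comm' x] at h₆
  simp only [obstructionCochain]
  -- Sum the cocycle identities over the signed (2,2)-shuffles of the two pairs.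
  linear_combination (norm := module) h₁ - h₂ + h₃ + h₄ - h₅ + h₆
end

section
/- Let H and H′ be groups, A an abelian group, and let ω and ω′ be normalized 3-cocycles on H and H′ respectively with values in A (trivial actions). Let ω̄ be the 3-cocycle on H × H′ given by ω̄((x,x′),(y,y′),(z,z′)) := ω(x,y,z) + ω′(x′,y′,z′). Fix h in the centre of H, h′ in the centre of H′, and a function γ : H × H′ → A. Then dγ = ω̄_{(h,h′)} holds if and only if: (i) γ(x,x′) = γ(x,e′) + γ(e,x′) for all x in H and x′ in H′, and (ii) the functions γ₁(x) := γ(x,e′) and γ₂(x′) := γ(e,x′) satisfy dγ₁ = ω_h and dγ₂ = ω′_{h′}. Here e, e′ denote the identity elements. -/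
/-- A 3-cochain is normalized if it vanishes whenever any argument is the identity. -/
def IsNormalizedThreeCochain {H : Type*} [Group H] {A : Type*} [AddCommGroup A]
    (ω : H → H → H → A) : Prop :=
  ∀ x y : H, ω 1 x y = 0 ∧ ω x 1 y = 0 ∧ ω x y 1 = 0

theorem obstructionCochain_one_right {H : Type*} [Group H] {A : Type*} [AddCommGroup A]
    {ω : H → H → H → A} (hn : IsNormalizedThreeCochain ω) (g x : H) :
    obstructionCochain ω g x 1 = 0 := by
  simp [obstructionCochain, (hn x g).2.2, (hn g x).2.2, (hn x g).2.1]

theorem obstructionCochain_one_left {H : Type*} [Group H] {A : Type*} [AddCommGroup A]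
    {ω : H → H → H → A} (hn : IsNormalizedThreeCochain ω) (g y : H) :
    obstructionCochain ω g 1 y = 0 := by
  simp [obstructionCochain, (hn g y).1, (hn g y).2.1, (hn y g).1]

/-- Half-braidings for the product cocycle `ω̄ = ω ⊕ ω′` on `H × H′` are exactly
products of half-braidings for `ω` and `ω′`. -/
theorem half_braiding_of_product
    {H H' : Type*} [Group H] [Group H'] {A : Type*} [AddCommGroup A]
    (ω : H → H → H → A) (ω' : H' → H' → H' → A)
    (hω : IsThreeCocycle ω) (hω' : IsThreeCocycle ω')
    (hn : IsNormalizedThreeCochain ω) (hn' : IsNormalizedThreeCochain ω')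
    (h : H) (hh : h ∈ Subgroup.center H)
    (h' : H') (hh' : h' ∈ Subgroup.center H')
    (γ : H × H' → A) :
    (∀ p q : H × H',
        γ (p * q) - γ p - γ q =
          obstructionCochain ω h p.1 q.1 + obstructionCochain ω' h' p.2 q.2) ↔
    ((∀ (x : H) (x' : H'), γ (x, x') = γ (x, 1) + γ (1, x')) ∧
     (∀ x y : H, γ (x * y, 1) - γ (x, 1) - γ (y, 1) = obstructionCochain ω h x y) ∧
     (∀ x' y' : H', γ (1, x' * y') - γ (1, x') - γ (1, y')
        = obstructionCochain ω' h' x' y')) := by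
  constructor
  · intro hγ
    refine ⟨fun x x' => ?_, fun x y => ?_, fun x' y' => ?_⟩
    · have key := hγ (x, 1) (1, x')
      simp only [Prod.mk_mul_mk, mul_one, one_mul, obstructionCochain_one_right hn,
        obstructionCochain_one_left hn', add_zero] at key
      rwa [sub_sub, sub_eq_zero] at key
    · simpa [obstructionCochain_one_right hn'] using hγ (x, 1) (y, 1)
    · simpa [obstructionCochain_one_right hn] using hγ (1, x') (1, y')
  · rintro ⟨hsplit, h₁, h₂⟩ ⟨x, x'⟩ ⟨y, y'⟩
    rw [Prod.mk_mul_mk, hsplit (x * y), hsplit x, hsplit y, ← h₁, ← h₂]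
    abel
end

section
/- Let A be an abelian group and q : A → U(1) a quadratic form. Let Z be a subgroup of A on which q is identically 1, and define Z⊥ := { x ∈ A : q(x+z) = q(x) for all z ∈ Z }. Then Z⊥ is a subgroup of A containing Z, the restriction of q to Z⊥ is constant on cosets of Z, and the induced function q̄ : Z⊥/Z → U(1) is again a quadratic form. -/
/-- The symmetric bicharacter associated to a `U(1)`-valued function on an abelian group:
`σ_q(a,b) = q(a+b)·q(a)⁻¹·q(b)⁻¹`. -/
noncomputable def assocBichar {A : Type*} [AddCommGroup A] (q : A → Circle)
    (a b : A) : Circle :=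
  q (a + b) * (q a)⁻¹ * (q b)⁻¹

/-- A quadratic form on an abelian group `A` with values in `U(1)`:
`q(n·a) = q(a)^(n²)` for all integers `n`, and the associated form `σ_q` is
biadditive. -/
def IsQuadraticForm {A : Type*} [AddCommGroup A] (q : A → Circle) : Prop :=
  (∀ (n : ℤ) (a : A), q (n • a) = q a ^ (n ^ 2)) ∧
  (∀ a b c : A, assocBichar q (a + b) c = assocBichar q a c * assocBichar q b c) ∧
  (∀ a b c : A, assocBichar q a (b + c) = assocBichar q a b * assocBichar q a c)

theorem assocBichar_eq_one_iff {A : Type*} [AddCommGroup A] {q : A → Circle} {a b : A}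
    (hb : q b = 1) : assocBichar q a b = 1 ↔ q (a + b) = q a := by
  simp [assocBichar, hb, mul_inv_eq_one]

/-- The elements orthogonal to `Z` with respect to the associated bicharacter. -/
def IsQuadraticForm.orthogonal {A : Type*} [AddCommGroup A] {q : A → Circle}
    (hq : IsQuadraticForm q) (Z : AddSubgroup A) : AddSubgroup A where
  carrier := {x | ∀ z ∈ Z, assocBichar q x z = 1}
  zero_mem' z _ := by simpa using hq.2.1 0 0 z
  add_mem' {a b} ha hb z hz := by rw [hq.2.1, ha z hz, hb z hz, mul_one]
  neg_mem' {a} ha z hz := by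
    have h0 : assocBichar q 0 z = 1 := by simpa using hq.2.1 0 0 z
    have h := hq.2.1 (-a) a z
    rwa [neg_add_cancel, h0, ha z hz, mul_one, eq_comm] at h

/-- A quadratic form restricts to a quadratic form along any homomorphism. -/
theorem IsQuadraticForm.comp {A B : Type*} [AddCommGroup A] [AddCommGroup B] {q : A → Circle}
    (hq : IsQuadraticForm q) (f : B →+ A) : IsQuadraticForm (q ∘ f) := by
  have h (a b : B) : assocBichar (q ∘ f) a b = assocBichar q (f a) (f b) := by
    simp [assocBichar]
  refine ⟨fun n a => ?_, fun a b c => ?_, fun a b c => ?_⟩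
  · simpa using hq.1 n (f a)
  · simpa only [h, map_add] using hq.2.1 (f a) (f b) (f c)
  · simpa only [h, map_add] using hq.2.2 (f a) (f b) (f c)

/-- A function is a quadratic form if its pullback along a surjective homomorphism is. -/
theorem IsQuadraticForm.of_comp_surjective {A B : Type*} [AddCommGroup A] [AddCommGroup B]
    {q : A → Circle} {f : B →+ A} (hf : Function.Surjective f)
    (hq : IsQuadraticForm (q ∘ f)) : IsQuadraticForm q := by
  have h (a b : B) : assocBichar (q ∘ f) a b = assocBichar q (f a) (f b) := by
    simp [assocBichar]
  refine ⟨fun n => hf.forall.2 fun a => ?_, hf.forall₃.2 fun a b c => ?_,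
    hf.forall₃.2 fun a b c => ?_⟩
  · simpa using hq.1 n a
  · simpa only [h, map_add] using hq.2.1 a b c
  · simpa only [h, map_add] using hq.2.2 a b c

/-- If `q` is a quadratic form vanishing on a subgroup `Z`, then
`Z⊥ = {x : q(x+z) = q(x) ∀ z ∈ Z}` is a subgroup containing `Z`, `q` is constant on
cosets of `Z` in `Z⊥`, and the induced function on `Z⊥/Z` is again a quadratic form. -/
theorem quadratic_form_descends_to_perp_quotient
    {A : Type*} [AddCommGroup A] (q : A → Circle) (hq : IsQuadraticForm q)
    (Z : AddSubgroup A) (hZ : ∀ z ∈ Z, q z = 1) :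
    ∃ P : AddSubgroup A,
      (∀ x : A, x ∈ P ↔ ∀ z ∈ Z, q (x + z) = q x) ∧
      Z ≤ P ∧
      (∀ x y : A, x ∈ P → y ∈ P → x - y ∈ Z → q x = q y) ∧
      ∃ qbar : (P ⧸ Z.addSubgroupOf P) → Circle,
        (∀ x : P, qbar (QuotientAddGroup.mk x) = q x) ∧ IsQuadraticForm qbar := by
  have hP (x : A) : x ∈ hq.orthogonal Z ↔ ∀ z ∈ Z, q (x + z) = q x :=
    forall₂_congr fun z hz => assocBichar_eq_one_iff (hZ z hz)
  have hcoset (x y : A) (hy : y ∈ hq.orthogonal Z) (hxy : x - y ∈ Z) : q x = q y := by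
    simpa using (hP y).1 hy (x - y) hxy
  let qbar : (hq.orthogonal Z ⧸ Z.addSubgroupOf (hq.orthogonal Z)) → Circle :=
    Quotient.lift (fun x => q x) fun x y hxy => by
      replace hxy := AddSubgroup.mem_addSubgroupOf.1 (QuotientAddGroup.leftRel_apply.1 hxy)
      refine (hcoset y x x.2 ?_).symm
      simpa [sub_eq_neg_add] using hxy
  refine ⟨hq.orthogonal Z, hP, fun z hz => (hP z).2 fun w hw => ?_,
    fun x y _ => hcoset x y, qbar, fun _ => rfl, ?_⟩
  · rw [hZ _ (Z.add_mem hz hw), hZ z hz]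
  · exact .of_comp_surjective (f := QuotientAddGroup.mk' (Z.addSubgroupOf (hq.orthogonal Z)))
      (QuotientAddGroup.mk'_surjective _) (hq.comp (hq.orthogonal Z).subtype)
end

section
/- Let A be a finitely generated abelian group and B an abelian group, and let β : A × A → B be a ℤ-bilinear (biadditive) map which is alternating, i.e. β(a,a) = 0 for all a ∈ A. Then there exists a ℤ-bilinear map η : A × A → B such that β(a,a′) = η(a,a′) − η(a′,a) for all a, a′ ∈ A. -/
/-- A finitely generated abelian group is a finite direct sum of cyclic groups, expressed through
the endomorphisms projecting onto the summands. -/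
theorem exists_cyclic_projections (A : Type*) [AddCommGroup A] [AddGroup.FG A] :
    ∃ (ι : Type) (_ : Fintype ι) (P : ι → A →+ A),
      (∀ a, ∑ i, P i a = a) ∧ ∀ i, ∃ g : A, ∀ a, ∃ k : ℤ, P i a = k • g := by
  classical
  obtain ⟨n, ι, _, p, _, r, ⟨e⟩⟩ := AddCommGroup.equiv_free_prod_directSum_zmod A
  let free (i : Fin n) : ℤ →+ A :=
    e.symm.toAddMonoidHom.comp ((AddMonoidHom.inl _ _).comp (Finsupp.singleAddHom i))
  let torsion (i : ι) : ZMod (p i ^ r i) →+ A :=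
    e.symm.toAddMonoidHom.comp ((AddMonoidHom.inr _ _).comp
      (DirectSum.of (fun i => ZMod (p i ^ r i)) i))
  refine ⟨Fin n ⊕ ι, inferInstance, Sum.elim
    (fun i => (free i).comp ((Finsupp.applyAddHom i).comp
      ((AddMonoidHom.fst _ _).comp e.toAddMonoidHom)))
    (fun i => (torsion i).comp ((DFinsupp.evalAddMonoidHom i).comp
      ((AddMonoidHom.snd _ _).comp e.toAddMonoidHom))), fun a => ?_, ?_⟩
  · have hfree : ∑ i, free i ((e a).1 i) = e.symm ((e a).1, 0) := by
      conv_rhs => rw [← Finsupp.univ_sum_single (e a).1]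
      exact (map_sum (e.symm.toAddMonoidHom.comp (AddMonoidHom.inl _ _)) _ _).symm
    have htorsion : ∑ i, torsion i ((e a).2 i) = e.symm (0, (e a).2) := by
      conv_rhs => rw [← DirectSum.sum_univ_of (e a).2]
      exact (map_sum (e.symm.toAddMonoidHom.comp (AddMonoidHom.inr _ _)) _ _).symm
    rw [Fintype.sum_sum_type]
    refine (congrArg₂ (· + ·) hfree htorsion).trans ?_
    simp [← map_add]
  · rintro (i | i)
    · refine ⟨free i 1, fun a => ⟨(e a).1 i, ?_⟩⟩
      rw [← map_zsmul, smul_eq_mul, mul_one]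
      rfl
    · refine ⟨torsion i 1, fun a => ?_⟩
      obtain ⟨k, hk⟩ := ZMod.intCast_surjective ((e a).2 i)
      refine ⟨k, ?_⟩
      rw [← map_zsmul, zsmul_one, hk]
      rfl

/-- Every alternating biadditive form on a finitely generated abelian group is the
antisymmetrisation `β(a,a′) = η(a,a′) − η(a′,a)` of some biadditive map `η`. -/
theorem alternating_biadditive_is_antisymmetrisation
    {A B : Type*} [AddCommGroup A] [AddCommGroup B] [AddGroup.FG A]
    (β : A → A → B)
    (hleft : ∀ a a' a'' : A, β (a + a') a'' = β a a'' + β a' a'')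
    (hright : ∀ a a' a'' : A, β a (a' + a'') = β a a' + β a a'')
    (halt : ∀ a : A, β a a = 0) :
    ∃ η : A → A → B,
      (∀ a a' a'' : A, η (a + a') a'' = η a a'' + η a' a'') ∧
      (∀ a a' a'' : A, η a (a' + a'') = η a a' + η a a'') ∧
      (∀ a a' : A, β a a' = η a a' - η a' a) := by
  classical
  let b : A →+ A →+ B :=
    AddMonoidHom.mk' (fun a => AddMonoidHom.mk' (β a) (hright a))
      fun a a' => AddMonoidHom.ext (hleft a a')
  have hb (a a' : A) : b a a' = β a a' := rfl
  have hskew (a a' : A) : b a a' = -b a' a := by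
    have h := halt (a + a')
    rw [hleft, hright, hright, halt, halt, zero_add, add_zero] at h
    exact eq_neg_of_add_eq_zero_left h
  obtain ⟨ι, _, P, hsum, hcyc⟩ := exists_cyclic_projections A
  let _ : LinearOrder ι := LinearOrder.lift' (Fintype.equivFin ι) (Fintype.equivFin ι).injective
  have hdiag (i : ι) (a a' : A) : b (P i a) (P i a') = 0 := by
    obtain ⟨g, hg⟩ := hcyc i
    obtain ⟨k, hk⟩ := hg a
    obtain ⟨l, hl⟩ := hg a'
    have hgg : b g g = 0 := halt g
    rw [hk, hl, map_zsmul, map_zsmul, AddMonoidHom.zsmul_apply, hgg, smul_zero, smul_zero]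
  refine ⟨fun a a' => ∑ i, ∑ j, if i < j then b (P i a) (P j a') else 0, ?_, ?_, ?_⟩
  · intro a a' a''
    simp only [← Finset.sum_add_distrib]
    refine Finset.sum_congr rfl fun i _ => Finset.sum_congr rfl fun j _ => ?_
    split_ifs <;> simp
  · intro a a' a''
    simp only [← Finset.sum_add_distrib]
    refine Finset.sum_congr rfl fun i _ => Finset.sum_congr rfl fun j _ => ?_
    split_ifs <;> simp
  · intro a a'
    have hexpand : β a a' = ∑ i, ∑ j, b (P i a) (P j a') := by
      simp_rw [← map_sum, hsum, ← AddMonoidHom.finsetSum_apply, ← map_sum, hsum, hb]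
    beta_reduce
    rw [hexpand, Finset.sum_comm (f := fun i j => if i < j then b (P i a') (P j a) else 0)]
    simp only [← Finset.sum_sub_distrib]
    refine Finset.sum_congr rfl fun i _ => Finset.sum_congr rfl fun j _ => ?_
    rcases lt_trichotomy i j with h | rfl | h
    · simp [h, h.not_gt]
    · simp [hdiag]
    · simp [h, h.not_gt, hskew (P i a)]
end
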